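/- Let G be a group with an exact factorization by subgroups G₊, G₋ (every x ∈ G is uniquely x = x₊ x₋⁻¹ with x₊ ∈ G₊, x₋ ∈ G₋), and let R be the Weinstein–Xu map R(x,y) = (y₋ x y₋⁻¹, a₊⁻¹ y a₊) with a = y₋ x y₋⁻¹. Let R̂ = σ ∘ R (σ the exchange of components) and, for n ≥ 2 and 1 ≤ i ≤ n−1, let R̂ᵢ : Gⁿ → Gⁿ apply R̂ to coordinates i, i+1 and the identity elsewhere. Define the change of variables Φ : Gⁿ → Gⁿ by Φ(x¹,…,xⁿ) = (y¹,…,yⁿ) with yⁱ = (xⁿ)₋ ⋯ (xⁱ⁺²)₋ (xⁱ⁺¹)₋ · xⁱ · (xⁱ⁺¹)₋⁻¹ (xⁱ⁺²)₋⁻¹ ⋯ (xⁿ)₋⁻¹ (and yⁿ = xⁿ). Then Φ is a bijection and intertwines the Weinstein–Xu braid action with the Artin action on the representation space: Φ ∘ R̂ᵢ = βᵢ ∘ Φ for each i, where βᵢ(g₁,…,gₙ) = (g₁,…,g_{i−1}, gᵢ⁻¹ gᵢ₊₁ gᵢ, gᵢ, gᵢ₊₂,…,gₙ). -/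

import Mathlib

variable {G : Type*} [Group G]

/-- The Weinstein–Xu map `R(x,y) = (y₋ x y₋⁻¹, a₊⁻¹ y a₊)` with
`a = y₋ x y₋⁻¹`, where `pl x = x₊` and `mi x = x₋` in the exact factorization
`x = x₊ x₋⁻¹`. -/
def wxR (pl mi : G → G) : G × G → G × G := fun p =>
  (mi p.2 * p.1 * (mi p.2)⁻¹,
    (pl (mi p.2 * p.1 * (mi p.2)⁻¹))⁻¹ * p.2 * pl (mi p.2 * p.1 * (mi p.2)⁻¹))

/-- `R̂ = σ ∘ R`, `σ` the exchange of components. -/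
def wxRhat (pl mi : G → G) : G × G → G × G := fun p =>
  ((wxR pl mi p).2, (wxR pl mi p).1)

/-- `R̂ᵢ` : apply a map of pairs to the coordinates `i, i+1` of `Gⁿ` and the
identity elsewhere. -/
def applyAt (F : G × G → G × G) (n i : ℕ) (h : i + 1 < n) :
    (Fin n → G) → (Fin n → G) := fun f =>
  Function.update (Function.update f ⟨i, by omega⟩
      (F (f ⟨i, by omega⟩, f ⟨i + 1, h⟩)).1) ⟨i + 1, h⟩
    (F (f ⟨i, by omega⟩, f ⟨i + 1, h⟩)).2

/-- The Artin braid action generator `βᵢ` on `Gⁿ`: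
`βᵢ(g₁,…,gₙ) = (g₁,…,g_{i-1}, gᵢ⁻¹gᵢ₊₁gᵢ, gᵢ, gᵢ₊₂,…,gₙ)`. -/
def braidAct (n i : ℕ) (h : i + 1 < n) : (Fin n → G) → (Fin n → G) := fun f =>
  Function.update (Function.update f ⟨i, by omega⟩
      ((f ⟨i, by omega⟩)⁻¹ * f ⟨i + 1, h⟩ * f ⟨i, by omega⟩)) ⟨i + 1, h⟩
    (f ⟨i, by omega⟩)

/-- Extension of a tuple `x : Fin n → G` to `ℕ → G` (by `1` outside). -/
def extTuple (n : ℕ) (x : Fin n → G) : ℕ → G :=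
  fun j => if h : j < n then x ⟨j, h⟩ else 1

/-- The conjugator `(xⁿ)₋ ⋯ (xⁱ⁺²)₋ (xⁱ⁺¹)₋` appearing in the change of
variables (0-based: the product `(x_{n-1})₋ ⋯ (x_{i+1})₋`). -/
def conjugator (mi : G → G) (n : ℕ) (x : Fin n → G) (i : ℕ) : G :=
  ((List.range (n - 1 - i)).map fun t => mi (extTuple n x (n - 1 - t))).prod

/-- The change of variables `Φ : Gⁿ → Gⁿ`,
`yⁱ = (xⁿ)₋ ⋯ (xⁱ⁺¹)₋ · xⁱ · (xⁱ⁺¹)₋⁻¹ ⋯ (xⁿ)₋⁻¹` (and `yⁿ = xⁿ`). -/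
def changeVar (mi : G → G) (n : ℕ) (x : Fin n → G) : Fin n → G := fun i =>
  conjugator mi n x i * x i * (conjugator mi n x i)⁻¹

theorem conjugator_of_le (mi : G → G) (n : ℕ) (x : Fin n → G) {i : ℕ} (h : n ≤ i + 1) :
    conjugator mi n x i = 1 := by
  have h0 : n - 1 - i = 0 := by omega
  simp [conjugator, h0]

theorem conjugator_eq_succ_mul (mi : G → G) (n : ℕ) (x : Fin n → G) {i : ℕ} (h : i + 1 < n) :
    conjugator mi n x i = conjugator mi n x (i + 1) * mi (x ⟨i + 1, h⟩) := by
  obtain ⟨k, rfl⟩ : ∃ k, n = k + i + 2 := ⟨n - i - 2, by omega⟩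
  have h1 : k + i + 2 - 1 - i = k + 1 := by omega
  have h2 : k + i + 2 - 1 - (i + 1) = k := by omega
  have h3 : k + i + 1 - k = i + 1 := by omega
  rw [conjugator, conjugator, h1, h2, List.range_succ, List.map_append, List.prod_append]
  simp [h3, extTuple]

theorem conjugator_eq_of_eq (mi : G → G) (n : ℕ) (x x' : Fin n → G) {j k : ℕ} (hjk : j ≤ k)
    (hk : conjugator mi n x k = conjugator mi n x' k)
    (hx : ∀ l : Fin n, j < l → (l : ℕ) ≤ k → x l = x' l) :
    conjugator mi n x j = conjugator mi n x' j := by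
  induction hjk using Nat.decreasingInduction with
  | self => exact hk
  | of_succ j hj ih =>
    by_cases h : j + 1 < n
    · rw [conjugator_eq_succ_mul mi n x h, conjugator_eq_succ_mul mi n x' h,
        ih fun l hl hlk => hx l (by omega) hlk, hx ⟨j + 1, h⟩ (Nat.lt_succ_self j) hj]
    · rw [conjugator_of_le mi n x (by omega), conjugator_of_le mi n x' (by omega)]

theorem conjugator_congr (mi : G → G) (n : ℕ) (x x' : Fin n → G) {j : ℕ}
    (hx : ∀ l : Fin n, j < l → x l = x' l) :
    conjugator mi n x j = conjugator mi n x' j :=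
  conjugator_eq_of_eq mi n x x' (Nat.le_add_right j n)
    (by rw [conjugator_of_le mi n x (by omega), conjugator_of_le mi n x' (by omega)])
    fun l hl _ => hx l hl

theorem changeVar_injective (mi : G → G) (n : ℕ) : Function.Injective (changeVar mi n) := by
  intro x x' hxx
  have key : ∀ k (j : Fin n), n ≤ j + k → x j = x' j := by
    intro k
    induction k with
    | zero => intro j hj; omega
    | succ k ih =>
      intro j hj
      have hc : conjugator mi n x j = conjugator mi n x' j :=
        conjugator_congr mi n x x' fun l hl => ih l (by omega)
      have hj' := congrFun hxx j
      simp only [changeVar, hc] at hj'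
      exact mul_left_cancel (mul_right_cancel hj')
  exact funext fun j => key n j (by omega)

theorem changeVar_surjective (mi : G → G) (n : ℕ) : Function.Surjective (changeVar mi n) := by
  intro y
  have key : ∀ k ≤ n, ∃ x : Fin n → G, ∀ j : Fin n, n ≤ j + k → changeVar mi n x j = y j := by
    intro k
    induction k with
    | zero => exact fun _ => ⟨y, fun j hj => by omega⟩
    | succ k ih =>
      intro hk
      obtain ⟨x, hx⟩ := ih (by omega)
      let i : Fin n := ⟨n - (k + 1), by omega⟩
      let c := conjugator mi n x i
      have hi : (i : ℕ) = n - (k + 1) := rfl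
      refine ⟨Function.update x i (c⁻¹ * y i * c), fun j hj => ?_⟩
      have hc : conjugator mi n (Function.update x i (c⁻¹ * y i * c)) j = conjugator mi n x j :=
        conjugator_congr mi n _ _ fun l hl =>
          Function.update_of_ne (by rintro rfl; omega) _ _
      by_cases hji : j = i
      · subst hji
        simp only [changeVar, hc, Function.update_self]
        simp only [c]
        group
      · have hlt : n ≤ j + k := by
          have : (j : ℕ) ≠ i := fun h => hji (Fin.ext h)
          omega
        rw [← hx j hlt]
        simp only [changeVar, hc, Function.update_of_ne hji]
  obtain ⟨x, hx⟩ := key n le_rfl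
  exact ⟨x, funext fun j => hx j (by omega)⟩

/-- The product of the `G₋`-parts is invariant under `R̂`. -/
theorem mi_mul_mi_wxRhat (Gp Gm : Subgroup G) (pl mi : G → G)
    (hfact : ∀ x : G, pl x ∈ Gp ∧ mi x ∈ Gm ∧ x = pl x * (mi x)⁻¹)
    (huniq : ∀ x p m, p ∈ Gp → m ∈ Gm → x = p * m⁻¹ → p = pl x ∧ m = mi x) (p : G × G) :
    mi (wxRhat pl mi p).2 * mi (wxRhat pl mi p).1 = mi p.2 * mi p.1 := by
  obtain ⟨x, y⟩ := p
  simp only [wxRhat, wxR]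
  set a := mi y * x * (mi y)⁻¹
  set b := (pl a)⁻¹ * y * pl a with hb
  obtain ⟨hxp, hxm, hx⟩ := hfact x
  obtain ⟨hyp, hym, hy⟩ := hfact y
  obtain ⟨hap, ham, haf⟩ := hfact a
  obtain ⟨hbp, hbm, hbf⟩ := hfact b
  have h1 : y * a = (pl y * pl x) * (mi y * mi x)⁻¹ := by
    calc y * a = (pl y * (mi y)⁻¹) * (mi y * (pl x * (mi x)⁻¹) * (mi y)⁻¹) := by
          rw [← hx, ← hy]
      _ = _ := by group
  have h2 : y * a = (pl a * pl b) * (mi a * mi b)⁻¹ := by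
    calc y * a = y * (pl a * (mi a)⁻¹) := by rw [← haf]
      _ = pl a * b * (mi a)⁻¹ := by rw [hb]; group
      _ = pl a * (pl b * (mi b)⁻¹) * (mi a)⁻¹ := by rw [← hbf]
      _ = _ := by group
  rw [(huniq _ _ _ (Gp.mul_mem hyp hxp) (Gm.mul_mem hym hxm) h1).2]
  exact (huniq _ _ _ (Gp.mul_mem hap hbp) (Gm.mul_mem ham hbm) h2).2

theorem mi_conj_wxRhat_fst (pl mi : G → G) (hfact : ∀ x : G, x = pl x * (mi x)⁻¹) (p : G × G) :
    mi (wxRhat pl mi p).2 * (wxRhat pl mi p).1 * (mi (wxRhat pl mi p).2)⁻¹ =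
      (wxRhat pl mi p).2⁻¹ * p.2 * (wxRhat pl mi p).2 := by
  simp only [wxRhat, wxR]
  set a := mi p.2 * p.1 * (mi p.2)⁻¹
  calc mi a * ((pl a)⁻¹ * p.2 * pl a) * (mi a)⁻¹
      = (pl a * (mi a)⁻¹)⁻¹ * p.2 * (pl a * (mi a)⁻¹) := by group
    _ = a⁻¹ * p.2 * a := by rw [← hfact a]

section applyAt

variable {X : Type*} (F : X × X → X × X) (n i : ℕ) (h : i + 1 < n) (x : Fin n → X)

theorem applyAt_apply_left :
    applyAt F n i h x ⟨i, by omega⟩ = (F (x ⟨i, by omega⟩, x ⟨i + 1, h⟩)).1 := by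
  simp [applyAt]

theorem applyAt_apply_right :
    applyAt F n i h x ⟨i + 1, h⟩ = (F (x ⟨i, by omega⟩, x ⟨i + 1, h⟩)).2 := by
  simp [applyAt]

theorem applyAt_apply_of_ne {j : Fin n} (h1 : (j : ℕ) ≠ i) (h2 : (j : ℕ) ≠ i + 1) :
    applyAt F n i h x j = x j := by
  simp [applyAt, Fin.ext_iff, h1, h2]

end applyAt

theorem braidAct_eq_applyAt (n i : ℕ) (h : i + 1 < n) (x : Fin n → G) :
    braidAct n i h x = applyAt (fun p : G × G => (p.1⁻¹ * p.2 * p.1, p.1)) n i h x := rfl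

/-- For a group `G` with an exact factorization, the change of variables `Φ` is
a bijection of `Gⁿ` intertwining the Weinstein–Xu braid action with the Artin
action on the representation space: `Φ ∘ R̂ᵢ = βᵢ ∘ Φ`. -/
theorem changeVar_intertwines (Gp Gm : Subgroup G) (pl mi : G → G)
    (hfact : ∀ x : G, pl x ∈ Gp ∧ mi x ∈ Gm ∧ x = pl x * (mi x)⁻¹)
    (huniq : ∀ x p m, p ∈ Gp → m ∈ Gm → x = p * m⁻¹ → p = pl x ∧ m = mi x)
    (n : ℕ) (hn : 2 ≤ n) :
    Function.Bijective (changeVar mi n) ∧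
    ∀ i (h : i + 1 < n),
      changeVar mi n ∘ applyAt (wxRhat pl mi) n i h
        = braidAct n i h ∘ changeVar mi n := by
  refine ⟨⟨changeVar_injective mi n, changeVar_surjective mi n⟩, fun i h => ?_⟩
  funext x j
  simp only [Function.comp_apply, braidAct_eq_applyAt]
  set x' := applyAt (wxRhat pl mi) n i h x
  have hi : i < n := by omega
  have hl : x' ⟨i, hi⟩ = _ := applyAt_apply_left (wxRhat pl mi) n i h x
  have hr : x' ⟨i + 1, h⟩ = _ := applyAt_apply_right (wxRhat pl mi) n i h x
  have hne (l : Fin n) (h1 : (l : ℕ) ≠ i) (h2 : (l : ℕ) ≠ i + 1) : x' l = x l :=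
    applyAt_apply_of_ne (wxRhat pl mi) n i h x h1 h2
  have hright (k : ℕ) (hk : i + 1 ≤ k) : conjugator mi n x' k = conjugator mi n x k :=
    conjugator_congr mi n x' x fun l hlk => hne l (by omega) (by omega)
  have hmid : conjugator mi n x' i = conjugator mi n x (i + 1) * mi (x' ⟨i + 1, h⟩) := by
    rw [conjugator_eq_succ_mul mi n x' h, hright _ le_rfl]
  have hleft (k : ℕ) (hk : k < i) : conjugator mi n x' k = conjugator mi n x k := by
    obtain ⟨m, rfl⟩ : ∃ m, i = m + 1 := ⟨i - 1, by omega⟩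
    refine conjugator_eq_of_eq mi n x' x (Nat.le_of_lt_succ hk) ?_
      fun l _ hlk => hne l (by omega) (by omega)
    rw [conjugator_eq_succ_mul mi n x' hi, conjugator_eq_succ_mul mi n x hi, hmid,
      conjugator_eq_succ_mul mi n x h, hl, hr, mul_assoc, mul_assoc,
      mi_mul_mi_wxRhat Gp Gm pl mi hfact huniq]
  have hr' : changeVar mi n x' ⟨i + 1, h⟩ = changeVar mi n x ⟨i, hi⟩ := by
    simp only [changeVar, hright _ le_rfl, conjugator_eq_succ_mul mi n x h, hr, wxRhat, wxR]
    group
  by_cases h1 : (j : ℕ) = i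
  · obtain rfl : j = ⟨i, hi⟩ := Fin.ext h1
    rw [applyAt_apply_left, ← hr']
    have key := mi_conj_wxRhat_fst pl mi (fun z => (hfact z).2.2) (x ⟨i, hi⟩, x ⟨i + 1, h⟩)
    rw [← hl, ← hr] at key
    simp only [changeVar, hmid, hright _ le_rfl]
    set c := conjugator mi n x (i + 1)
    calc _ = c * (mi (x' ⟨i + 1, h⟩) * x' ⟨i, hi⟩ * (mi (x' ⟨i + 1, h⟩))⁻¹) * c⁻¹ := by group
      _ = _ := by rw [key]; group
  by_cases h2 : (j : ℕ) = i + 1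
  · obtain rfl : j = ⟨i + 1, h⟩ := Fin.ext h2
    rw [applyAt_apply_right, hr']
  · have hc : conjugator mi n x' j = conjugator mi n x j := by
      rcases lt_or_gt_of_ne h1 with hlt | hgt
      · exact hleft _ hlt
      · exact hright _ hgt
    rw [applyAt_apply_of_ne _ _ _ _ _ h1 h2]
    simp only [changeVar, hc, hne j h1 h2]
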